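/- Let f be defined on the open unit ball B of ℓ² by f(x) = Σ_{n=1}^∞ x_n^{2n}. Then there is no convex function F : ℓ² → ℝ that is bounded on bounded subsets of ℓ² and satisfies F(x) = f(x) for every x ∈ B. -/

import Mathlib

open Filter Topology in
/-- If `g` is convex and equals `t ^ m` on `[0, 1)`, then its value at `2` lies above the chord
through `a` and `1`. -/
theorem ConvexOn.two_sub_le_of_eq_pow {g : ℝ → ℝ} (hg : ConvexOn ℝ Set.univ g) {m : ℕ}
    (h : ∀ t, 0 ≤ t → t < 1 → g t = t ^ m) {a : ℝ} (ha : 0 ≤ a) (ha1 : a < 1) :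
    2 - a ≤ a ^ m + (1 - a) * g 2 := by
  have key : ∀ b ∈ Set.Ioo a 1, (2 - a) * b ^ m ≤ (2 - b) * a ^ m + (b - a) * g 2 := by
    rintro b ⟨hab, hb⟩
    have h2 : (0 : ℝ) < 2 - a := by linarith
    have hw : (2 - b) / (2 - a) + (b - a) / (2 - a) = 1 := by field_simp; ring
    have hc := hg.2 (Set.mem_univ a) (Set.mem_univ (2 : ℝ))
      (div_nonneg (by linarith) h2.le) (div_nonneg (by linarith) h2.le) hw
    have hb' : ((2 - b) / (2 - a)) • a + ((b - a) / (2 - a)) • (2 : ℝ) = b := by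
      simp only [smul_eq_mul]; field_simp; ring
    rw [hb', h b (by linarith) hb, h a ha ha1, smul_eq_mul, smul_eq_mul, div_mul_eq_mul_div,
      div_mul_eq_mul_div, ← add_div, le_div_iff₀ h2] at hc
    linarith
  have hl : Tendsto (fun b : ℝ => (2 - a) * b ^ m) (𝓝[<] 1) (𝓝 ((2 - a) * 1 ^ m)) :=
    ((by fun_prop : Continuous fun b : ℝ => (2 - a) * b ^ m).tendsto 1).mono_left
      nhdsWithin_le_nhds
  have hr : Tendsto (fun b : ℝ => (2 - b) * a ^ m + (b - a) * g 2) (𝓝[<] 1)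
      (𝓝 ((2 - 1) * a ^ m + (1 - a) * g 2)) :=
    ((by fun_prop : Continuous fun b : ℝ => (2 - b) * a ^ m + (b - a) * g 2).tendsto 1).mono_left
      nhdsWithin_le_nhds
  have := le_of_tendsto_of_tendsto hl hr (by
    filter_upwards [Ioo_mem_nhdsLT ha1] with b hb using key b hb)
  simp only [one_pow] at this
  linarith

/-- There is no convex function `F : ℓ² → ℝ`, bounded on bounded subsets of
`ℓ²`, agreeing with `f(x) = Σ_{n≥1} x_n^{2n}` on the open unit ball of `ℓ²`. -/
theorem no_convex_boundedOnBounded_extension_to_l2 :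
    ¬ ∃ F : lp (fun _ : ℕ => ℝ) 2 → ℝ, ConvexOn ℝ Set.univ F ∧
      (∀ B : Set (lp (fun _ : ℕ => ℝ) 2), Bornology.IsBounded B →
        Bornology.IsBounded (F '' B)) ∧
      ∀ x : lp (fun _ : ℕ => ℝ) 2, ‖x‖ < 1 →
        F x = ∑' n : ℕ, (x n) ^ (2 * (n + 1)) := by
  rintro ⟨F, hF, hbdd, hf⟩
  let e : ℕ → lp (fun _ : ℕ => ℝ) 2 := fun n => lp.single 2 n (1 : ℝ)
  have he : ∀ n, ‖e n‖ = 1 := fun n => by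
    simp [e, lp.norm_single]
  obtain ⟨M, hM⟩ := (hbdd _ (Metric.isBounded_closedBall (x := 0) (r := 2))).exists_norm_le
  have hFM : ∀ n, F ((2 : ℝ) • e n) ≤ M := fun n =>
    (le_abs_self _).trans (hM _ ⟨_, by simp [norm_smul, he], rfl⟩)
  have hM0 : 0 ≤ M := (norm_nonneg _).trans (hM _ ⟨(2 : ℝ) • e 0, by simp [norm_smul, he], rfl⟩)
  have hline : ∀ n, ConvexOn ℝ Set.univ fun t : ℝ => F (t • e n) := fun n =>
    hF.comp_linearMap (LinearMap.toSpanSingleton ℝ _ (e n))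
  have hpow : ∀ n (t : ℝ), 0 ≤ t → t < 1 → F (t • e n) = t ^ (2 * (n + 1)) := by
    intro n t ht ht1
    rw [hf _ (by rw [norm_smul, he, mul_one, Real.norm_of_nonneg ht]; exact ht1),
      tsum_eq_single n]
    · simp [e]
    · intro k hk
      simp [e, lp.single_apply, hk]
  set δ : ℝ := 1 / (M + 1) with hδ
  have hδ0 : 0 < δ := by positivity
  have hδ1 : δ ≤ 1 := by
    rw [hδ, div_le_one (by positivity)]; linarith
  have hδM : δ * M + δ = 1 := by rw [hδ]; field_simp
  obtain ⟨n, hn⟩ := exists_pow_lt_of_lt_one hδ0 (show 1 - δ < 1 by linarith)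
  have h1 := (hline n).two_sub_le_of_eq_pow (hpow n) (a := 1 - δ) (by linarith) (by linarith)
  have h2 : (1 - δ) ^ (2 * (n + 1)) ≤ (1 - δ) ^ n :=
    pow_le_pow_of_le_one (by linarith) (by linarith) (by omega)
  have h3 := mul_le_mul_of_nonneg_left (hFM n) hδ0.le
  simp only [sub_sub_cancel] at h1
  linarith
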